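/- (Coercivity step of the inf-sup proof.) For all u ∈ V and η ∈ W, taking v = u and w = η + k·D u one has â((u,η),(v,w)) ≥ (1/2) · ‖(u,η)‖_b̂². -/

import Mathlib

open scoped RealInnerProductSpace

/-- Coercivity step of the inf-sup proof: with the test functions `v = u` and
`w = η + k • D u` one has `â((u,η),(v,w)) ≥ (1/2) ‖(u,η)‖_b̂²`. -/
theorem tide_form_coercivity_step
    {V W : Type*} [NormedAddCommGroup V] [InnerProductSpace ℝ V]
    [NormedAddCommGroup W] [InnerProductSpace ℝ W]
    (m : V →ₗ[ℝ] V →ₗ[ℝ] ℝ)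
    (hm_symm : ∀ u v : V, m u v = m v u)
    (hm_pos : ∀ u : V, u ≠ 0 → 0 < m u u)
    (aW : W →ₗ[ℝ] W →ₗ[ℝ] ℝ)
    (haW_symm : ∀ w w' : W, aW w w' = aW w' w)
    (haW_nonneg : ∀ w : W, 0 ≤ aW w w)
    (D : V →ₗ[ℝ] W) (B : V →ₗ[ℝ] V) (J : V →ₗ[ℝ] V)
    (hJ : ∀ u : V, m (J u) u = 0)
    (hB : ∀ u : V, 0 ≤ ⟪B u, u⟫)
    (k ε Fr : ℝ) (hk : 0 < k) (hε : 0 < ε) (hFr : 0 < Fr) :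
    ∀ (u : V) (η : W),
      m u u + (k / ε) * m (J u) u + k * ⟪B u, u⟫
          - Fr ^ 2 * k * aW η (D u)
          + Fr ^ 2 * aW η (η + k • D u)
          + Fr ^ 2 * k * aW (D u) (η + k • D u)
        ≥ (1 / 2) * (m u u + Fr ^ 2 * k ^ 2 * aW (D u) (D u) + Fr ^ 2 * aW η η) := by
  intro u η
  have hm : 0 ≤ m u u := by
    rcases eq_or_ne u 0 with rfl | hu
    · simp
    · exact (hm_pos u hu).le
  have hkB : 0 ≤ k * ⟪B u, u⟫ := mul_nonneg hk.le (hB u)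
  have hsq : 0 ≤ Fr ^ 2 * aW (η + k • D u) (η + k • D u) :=
    mul_nonneg (sq_nonneg Fr) (haW_nonneg _)
  simp only [map_add, map_smul, LinearMap.add_apply, LinearMap.smul_apply, smul_eq_mul,
    haW_symm η (D u)] at hsq ⊢
  rw [hJ]
  linarith
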